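/- Let G be a finite connected simple graph with sink r, source set U ⊆ V∖{r}, report sizes s with s(u) ≥ 1 for u ∈ U and s(v) = 0 otherwise, aggregation ratio q ≥ 1, and Tx, Rx > 0. Then every routing tree with relay nodes T satisfies COST(T) ≥ (Tx+Rx)·Σ_{u∈U} s(u)·dist_G(u,r)/q, where dist_G(u,r) is the hop distance from u to r in G. -/

import Mathlib

open Finset

variable {V : Type*} [Fintype V] [DecidableEq V]

/-- A routing tree with relay nodes for a network `G` with sink `r` and source set `U`:
a subtree of `G` rooted at `r` whose vertex set contains `U ∪ {r}`. Every vertex `v ≠ r`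
of the tree has a unique parent adjacent to it in `G`, and iterating parents reaches `r`. -/
structure RelayTree (G : SimpleGraph V) (r : V) (U : Finset V) where
  verts : Finset V
  root_mem : r ∈ verts
  source_subset : U ⊆ verts
  parent : V → V
  parent_mem : ∀ v ∈ verts, parent v ∈ verts
  parent_root : parent r = r
  adj : ∀ v ∈ verts, v ≠ r → G.Adj v (parent v)
  reaches : ∀ v ∈ verts, ∃ n, parent^[n] v = r

open scoped Classical in
/-- `desR s T v`: the total size of reports of the proper descendants of `v` in `T`,
i.e. of the vertices `u ≠ v` of `T` whose tree path to the root passes through `v`. -/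
noncomputable def desR {G : SimpleGraph V} {r : V} {U : Finset V} (s : V → ℕ)
    (T : RelayTree G r U) (v : V) : ℕ :=
  ∑ u ∈ T.verts, if u ≠ v ∧ (∃ n, T.parent^[n] u = v) then s u else 0

/-- The energy cost of a routing tree with relay nodes:
`COST(T) = (Tx+Rx) · Σ_{v ∈ V(T), v ≠ r} ⌈(des_T(v)+s(v))/q⌉`. -/
noncomputable def costR {G : SimpleGraph V} {r : V} {U : Finset V} (s : V → ℕ) (q : ℕ)
    (Tx Rx : ℝ) (T : RelayTree G r U) : ℝ :=
  (Tx + Rx) * ∑ v ∈ T.verts.erase r, (⌈(((desR s T v + s v : ℕ) : ℝ) / (q : ℝ))⌉ : ℝ)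

/-- The hop distance from `v` to the root `r` in the tree `T`. -/
noncomputable def relayDist {G : SimpleGraph V} {r : V} {U : Finset V}
    (T : RelayTree G r U) (v : V) : ℕ :=
  sInf {n : ℕ | T.parent^[n] v = r}

/-- The minimum number of edges of a connected subgraph of `G` containing `U ∪ {r}`
(the number of edges of a minimum Steiner tree for `U ∪ {r}`). -/
noncomputable def steinerEdges (G : SimpleGraph V) (U : Finset V) (r : V) : ℕ :=
  sInf {k : ℕ | ∃ H : G.Subgraph, H.Connected ∧ (↑U ∪ {r} : Set V) ⊆ H.verts ∧
    H.edgeSet.ncard = k}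

namespace RelayTree

variable {G : SimpleGraph V} {r : V} {U : Finset V}

open scoped Classical in
/-- The vertices other than the root on the tree path from `u` to the root. -/
noncomputable def pathVerts (T : RelayTree G r U) (u : V) : Finset V :=
  {v ∈ T.verts.erase r | ∃ n, T.parent^[n] u = v}

theorem mem_pathVerts {T : RelayTree G r U} {u v : V} :
    v ∈ T.pathVerts u ↔ (v ≠ r ∧ v ∈ T.verts) ∧ ∃ n, T.parent^[n] u = v := by
  simp [pathVerts]

theorem pathVerts_parent_subset (T : RelayTree G r U) (u : V) :
    T.pathVerts (T.parent u) ⊆ T.pathVerts u := by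
  intro v hv
  obtain ⟨h, n, hn⟩ := mem_pathVerts.1 hv
  exact mem_pathVerts.2 ⟨h, n + 1, hn⟩

theorem Icc_dist_subset_image_pathVerts (T : RelayTree G r U) (hG : G.Connected)
    {u : V} (hu : u ∈ T.verts) :
    Icc 1 (G.dist u r) ⊆ (T.pathVerts u).image (G.dist · r) := by
  obtain ⟨n, hn⟩ := T.reaches u hu
  induction n generalizing u with
  | zero =>
    obtain rfl : u = r := hn
    simp
  | succ n ih =>
    by_cases hur : u = r
    · simp [hur]
    intro k hk
    rw [mem_Icc] at hk
    rcases eq_or_ne k (G.dist u r) with rfl | hne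
    · exact mem_image_of_mem (G.dist · r) (mem_pathVerts.2 ⟨⟨hur, hu⟩, 0, rfl⟩)
    · have hdist : G.dist u r ≤ 1 + G.dist (T.parent u) r := by
        rw [← SimpleGraph.dist_eq_one_iff_adj.2 (T.adj u hu hur)]
        exact hG.dist_triangle
      exact image_subset_image (T.pathVerts_parent_subset u)
        (ih (T.parent_mem u hu) hn (mem_Icc.2 ⟨hk.1, by omega⟩))

theorem dist_le_card_pathVerts (T : RelayTree G r U) (hG : G.Connected)
    {u : V} (hu : u ∈ T.verts) : G.dist u r ≤ #(T.pathVerts u) := by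
  simpa using (card_le_card (T.Icc_dist_subset_image_pathVerts hG hu)).trans card_image_le

open scoped Classical in
theorem desR_add_self (T : RelayTree G r U) (s : V → ℕ) {v : V} (hv : v ∈ T.verts) :
    desR s T v + s v = ∑ u ∈ T.verts, if ∃ n, T.parent^[n] u = v then s u else 0 := by
  have hs : s v = ∑ u ∈ T.verts, if u = v then s u else 0 := by simp [hv]
  rw [hs, desR, ← sum_add_distrib]
  refine sum_congr rfl fun u _ => ?_
  by_cases huv : u = v
  · simp [huv, show ∃ n, T.parent^[n] v = v from ⟨0, rfl⟩]
  · simp [huv]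

theorem sum_desR_add_self (T : RelayTree G r U) (s : V → ℕ) :
    ∑ v ∈ T.verts.erase r, (desR s T v + s v) = ∑ u ∈ T.verts, s u * #(T.pathVerts u) := by
  classical
  rw [sum_congr rfl fun v hv => T.desR_add_self s (mem_of_mem_erase hv), sum_comm]
  refine sum_congr rfl fun u _ => ?_
  rw [← sum_filter, sum_const, smul_eq_mul, mul_comm, pathVerts]

theorem sum_mul_dist_le (T : RelayTree G r U) (hG : G.Connected) (s : V → ℕ) :
    ∑ u ∈ U, s u * G.dist u r ≤ ∑ v ∈ T.verts.erase r, (desR s T v + s v) := by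
  rw [sum_desR_add_self]
  calc ∑ u ∈ U, s u * G.dist u r
      ≤ ∑ u ∈ T.verts, s u * G.dist u r := sum_le_sum_of_subset T.source_subset
    _ ≤ _ := sum_le_sum fun u hu => Nat.mul_le_mul_left _ (T.dist_le_card_pathVerts hG hu)

end RelayTree

/-- Every routing tree with relay nodes `T` satisfies
`COST(T) ≥ (Tx+Rx) · Σ_{u∈U} s(u)·dist_G(u,r)/q`. -/
theorem costR_ge_fractional_distance_sum (G : SimpleGraph V) (hG : G.Connected) (r : V)
    (U : Finset V) (hU : r ∉ U)
    (s : V → ℕ) (hsU : ∀ u ∈ U, 1 ≤ s u) (hs0 : ∀ v, v ∉ U → s v = 0)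
    (q : ℕ) (hq : 1 ≤ q) (Tx Rx : ℝ) (hTx : 0 < Tx) (hRx : 0 < Rx)
    (T : RelayTree G r U) :
    (Tx + Rx) * ∑ u ∈ U, ((s u : ℝ) * (G.dist u r : ℝ) / (q : ℝ)) ≤
      costR s q Tx Rx T := by
  refine mul_le_mul_of_nonneg_left ?_ (add_pos hTx hRx).le
  calc ∑ u ∈ U, ((s u : ℝ) * (G.dist u r : ℝ) / (q : ℝ))
      = ((∑ u ∈ U, s u * G.dist u r : ℕ) : ℝ) / q := by push_cast; rw [sum_div]
    _ ≤ ((∑ v ∈ T.verts.erase r, (desR s T v + s v) : ℕ) : ℝ) / q := by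
      gcongr
      exact T.sum_mul_dist_le hG s
    _ = ∑ v ∈ T.verts.erase r, ((desR s T v + s v : ℕ) : ℝ) / q := by
      rw [Nat.cast_sum, sum_div]
    _ ≤ _ := sum_le_sum fun v _ => Int.le_ceil _
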